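/- If τ = σᵏ|_{D∪B} is a main sub-substitution of σ (i.e., D ⊆ C_niso is a minimal alphabet of period k), then X_τ is a minimal component of X_σ. -/

import Mathlib

open List
open scoped Classical

namespace SubstPaper

variable {A : Type*}

/-- Apply a substitution letterwise to a word. -/
def applyW (σ : A → List A) (u : List A) : List A := u.flatMap σ

/-- `n`-th iterate of a substitution on a word. -/
def iterW (σ : A → List A) (n : ℕ) (u : List A) : List A := (applyW σ)^[n] u

/-- Non-erasing substitution. -/
def NonErasing (σ : A → List A) : Prop := ∀ a, σ a ≠ []

/-- A letter is bounded if the lengths of its iterated images stay bounded. -/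
def IsBounded (σ : A → List A) (a : A) : Prop := ∃ K, ∀ n, (iterW σ n [a]).length ≤ K

/-- A letter is growing if it is not bounded. -/
def IsGrowing (σ : A → List A) (a : A) : Prop := ¬ IsBounded σ a

/-- The prefix of `u` consisting of bounded letters, before the first growing letter. -/
noncomputable def LBw (σ : A → List A) (u : List A) : List A :=
  u.takeWhile (fun a => decide (IsBounded σ a))

/-- The first growing letter of `u` (junk value if none). -/
noncomputable def LCw [Inhabited A] (σ : A → List A) (u : List A) : A :=
  (u.dropWhile (fun a => decide (IsBounded σ a))).headI

/-- The bounded suffix of `u`, after the last growing letter. -/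
noncomputable def RBw (σ : A → List A) (u : List A) : List A :=
  (LBw σ u.reverse).reverse

/-- The last growing letter of `u` (junk value if none). -/
noncomputable def RCw [Inhabited A] (σ : A → List A) (u : List A) : A :=
  LCw σ u.reverse

/-- Growing letters occurring in a word. -/
def alphC (σ : A → List A) (u : List A) : Set A := {c | IsGrowing σ c ∧ c ∈ u}

/-- The map on alphabets induced by the substitution: `D ↦ ⋃_{a ∈ D} alph_C(σ(a))`. -/
def FAlph (σ : A → List A) (D : Set A) : Set A := ⋃ a ∈ D, alphC σ (σ a)

/-- `D` is a `k`-periodic alphabet: nonempty set of growing letters, `k` least positive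
with `F^[k] D = D`. -/
def IsKPeriodicAlph (σ : A → List A) (D : Set A) (k : ℕ) : Prop :=
  D.Nonempty ∧ (∀ a ∈ D, IsGrowing σ a) ∧ 0 < k ∧ (FAlph σ)^[k] D = D ∧
    ∀ j, 0 < j → (FAlph σ)^[j] D = D → k ≤ j

/-- `D` is a minimal alphabet: periodic with no proper nonempty periodic subalphabet. -/
def IsMinimalAlph (σ : A → List A) (D : Set A) : Prop :=
  (∃ k, IsKPeriodicAlph σ D k) ∧
    ∀ D' ⊆ D, D'.Nonempty → (∃ k', IsKPeriodicAlph σ D' k') → D' = D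

/-- The finite word `u` occurs in the bi-infinite word `x`. -/
def OccursIn (x : ℤ → A) (u : List A) : Prop :=
  ∃ i : ℤ, ∀ j : Fin u.length, x (i + j.1) = u.get j

/-- The substitution subshift `X_σ`. -/
def Xsub (σ : A → List A) : Set (ℤ → A) :=
  {x | ∀ u, OccursIn x u → ∃ a n, u <:+: iterW σ n [a]}

/-- The left shift on bi-infinite words. -/
def shiftT (x : ℤ → A) : ℤ → A := fun i => x (i + 1)

/-- A subshift: nonempty, closed, shift-invariant. -/
def IsSubshift [TopologicalSpace A] (X : Set (ℤ → A)) : Prop :=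
  X.Nonempty ∧ IsClosed X ∧ shiftT '' X = X

/-- A minimal subshift: contains no proper subshift. -/
def IsMinimalSubshift [TopologicalSpace A] (X : Set (ℤ → A)) : Prop :=
  IsSubshift X ∧ ∀ Y ⊆ X, IsSubshift Y → Y = X

/-- The periodic bi-infinite word `ωuω`. -/
noncomputable def perWord [Inhabited A] (u : List A) : ℤ → A :=
  fun i => u.getD ((i % (u.length : ℤ)).toNat) default

/-- The shift-orbit closure `X(x)` of a bi-infinite word. -/
def orbitClosure [TopologicalSpace A] (x : ℤ → A) : Set (ℤ → A) :=
  closure {y | ∃ k : ℤ, ∀ i, y i = x (i + k)}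

/-- `x` is the letterwise image of `y` under `σ`, with the origin at the image of
position `0`. -/
def IsSubstImage (σ : A → List A) (y x : ℤ → A) : Prop :=
  ∃ c : ℤ → ℤ, c 0 = 0 ∧ (∀ i, c (i + 1) = c i + (σ (y i)).length) ∧
    ∀ i : ℤ, ∀ j : Fin (σ (y i)).length, x (c i + j.1) = (σ (y i)).get j

/-- The induced map `σ̃` on subshifts: all shifts of images of elements of `X`. -/
def tildeS (σ : A → List A) (X : Set (ℤ → A)) : Set (ℤ → A) :=
  {z | ∃ x ∈ X, ∃ k : ℤ, IsSubstImage σ x (fun i => z (i + k))}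

/-- Growing letters occurring in some element of `X`. -/
def alphCX (σ : A → List A) (X : Set (ℤ → A)) : Set A :=
  {c | IsGrowing σ c ∧ ∃ x ∈ X, ∃ i : ℤ, x i = c}

/-- The subshift of the restriction `σᵏ|_E` (words whose factors occur in some
`σ^{kn}(a)`, `a ∈ E`). -/
def Xrestr (σ : A → List A) (E : Set A) (k : ℕ) : Set (ℤ → A) :=
  {x | ∀ u, OccursIn x u → ∃ a ∈ E, ∃ n, u <:+: iterW σ (k * n) [a]}

/-- A growing letter `c` is left-isolated: `σⁿ(c) = u c v` with `u` nonempty bounded. -/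
def LeftIsolated (σ : A → List A) (c : A) : Prop :=
  IsGrowing σ c ∧ ∃ n, 1 ≤ n ∧ ∃ u v : List A, u ≠ [] ∧ (∀ b ∈ u, IsBounded σ b) ∧
    iterW σ n [c] = u ++ c :: v

/-- A growing letter `c` is right-isolated: `σⁿ(c) = v c u` with `u` nonempty bounded. -/
def RightIsolated (σ : A → List A) (c : A) : Prop :=
  IsGrowing σ c ∧ ∃ n, 1 ≤ n ∧ ∃ u v : List A, u ≠ [] ∧ (∀ b ∈ u, IsBounded σ b) ∧
    iterW σ n [c] = v ++ c :: u

/-- Growing letter that is neither left- nor right-isolated (member of `C_niso`). -/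
def NonIsolated (σ : A → List A) (c : A) : Prop :=
  IsGrowing σ c ∧ ¬ LeftIsolated σ c ∧ ¬ RightIsolated σ c

/-- A periodic letter: bounded, and occurring in some `σⁿ(a)`, `n ≥ 1`. -/
def IsPeriodicLetter (σ : A → List A) (a : A) : Prop :=
  IsBounded σ a ∧ ∃ n, 1 ≤ n ∧ [a] <:+: iterW σ n [a]

/-- `(a,u,b)` is a 1-block of the word `w`. -/
def Is1Block (σ : A → List A) (w : List A) (t : A × List A × A) : Prop :=
  IsGrowing σ t.1 ∧ IsGrowing σ t.2.2 ∧ (∀ x ∈ t.2.1, IsBounded σ x) ∧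
    (t.1 :: (t.2.1 ++ [t.2.2])) <:+: w

/-- The descendant map on 1-blocks. -/
noncomputable def Desc [Inhabited A] (σ : A → List A) : A × List A × A → A × List A × A :=
  fun t => (RCw σ (σ t.1), RBw σ (σ t.1) ++ applyW σ t.2.1 ++ LBw σ (σ t.2.2), LCw σ (σ t.2.2))

/-- The bi-infinite word `ωu.wvω`. -/
noncomputable def biWord [Inhabited A] (u w v : List A) : ℤ → A := fun i =>
  if i < 0 then u.getD ((i % (u.length : ℤ)).toNat) default
  else if i < (w.length : ℤ) then w.getD i.toNat default
  else v.getD (((i - (w.length : ℤ)) % (v.length : ℤ)).toNat) default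

/-! ### Iterates of a substitution -/

theorem iterW_zero (σ : A → List A) (u : List A) : iterW σ 0 u = u := rfl

theorem iterW_succ (σ : A → List A) (n : ℕ) (u : List A) :
    iterW σ (n + 1) u = iterW σ n (applyW σ u) := rfl

theorem iterW_succ' (σ : A → List A) (n : ℕ) (u : List A) :
    iterW σ (n + 1) u = applyW σ (iterW σ n u) :=
  Function.iterate_succ_apply' _ _ _

theorem iterW_add (σ : A → List A) (m n : ℕ) (u : List A) :
    iterW σ (m + n) u = iterW σ m (iterW σ n u) :=
  Function.iterate_add_apply _ _ _ _

theorem iterW_nil (σ : A → List A) (n : ℕ) : iterW σ n [] = [] := by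
  induction n with
  | zero => rfl
  | succ n ih => rw [iterW_succ]; exact ih

theorem iterW_append (σ : A → List A) (n : ℕ) (u v : List A) :
    iterW σ n (u ++ v) = iterW σ n u ++ iterW σ n v := by
  induction n generalizing u v with
  | zero => rfl
  | succ n ih => simp only [iterW_succ, applyW, flatMap_append, ih]

theorem iterW_eq_flatMap (σ : A → List A) (n : ℕ) (u : List A) :
    iterW σ n u = u.flatMap fun a => iterW σ n [a] := by
  induction u with
  | nil => simp [iterW_nil]
  | cons a u ih => rw [← singleton_append, iterW_append, ih]; simp

theorem iterW_succ_singleton (σ : A → List A) (n : ℕ) (a : A) :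
    iterW σ (n + 1) [a] = iterW σ n (σ a) := by
  rw [iterW_succ]; simp [applyW]

theorem iterW_iterW (σ : A → List A) (k n : ℕ) (u : List A) :
    iterW (fun a => iterW σ k [a]) n u = iterW σ (k * n) u := by
  induction n generalizing u with
  | zero => rfl
  | succ n ih =>
    rw [iterW_succ, ih, Nat.mul_succ, iterW_add, applyW, ← iterW_eq_flatMap]

theorem iterW_infix (σ : A → List A) (n : ℕ) {u v : List A} (h : u <:+: v) :
    iterW σ n u <:+: iterW σ n v := by
  rw [iterW_eq_flatMap σ n u, iterW_eq_flatMap σ n v]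
  exact h.flatMap _

theorem mem_iterW_iff (σ : A → List A) (n : ℕ) (u : List A) (x : A) :
    x ∈ iterW σ n u ↔ ∃ a ∈ u, x ∈ iterW σ n [a] := by
  rw [iterW_eq_flatMap, mem_flatMap]

theorem iterW_reverse (σ : A → List A) (n : ℕ) (u : List A) :
    iterW (fun a => (σ a).reverse) n u.reverse = (iterW σ n u).reverse := by
  induction n generalizing u with
  | zero => rfl
  | succ n ih =>
    rw [iterW_succ, iterW_succ, ← ih]
    congr 1
    simp only [applyW, reverse_flatMap]
    rfl

theorem iterW_reverse_singleton (σ : A → List A) (n : ℕ) (a : A) :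
    iterW (fun a => (σ a).reverse) n [a] = (iterW σ n [a]).reverse := by
  simpa using iterW_reverse σ n [a]

theorem length_le_length_applyW {σ : A → List A} (hσ : NonErasing σ) (u : List A) :
    u.length ≤ (applyW σ u).length := by
  induction u with
  | nil => simp
  | cons a u ih =>
    have : 0 < (σ a).length := length_pos_iff.2 (hσ a)
    simp only [applyW, flatMap_cons, length_append, length_cons] at ih ⊢
    omega

theorem monotone_length_iterW {σ : A → List A} (hσ : NonErasing σ) (u : List A) :
    Monotone fun n => (iterW σ n u).length :=
  monotone_nat_of_le_succ fun n => by
    simp only [iterW_succ']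
    exact length_le_length_applyW hσ _

theorem iterW_ne_nil {σ : A → List A} (hσ : NonErasing σ) (n : ℕ) {u : List A} (hu : u ≠ []) :
    iterW σ n u ≠ [] := by
  have h := monotone_length_iterW hσ u (Nat.zero_le n)
  have := length_pos_iff.2 hu
  simp only [iterW_zero] at h
  exact length_pos_iff.1 (by omega)

/-! ### Factors of concatenations -/

theorem prefix_append_cases {p u v : List A} (h : p <+: u ++ v) :
    p <+: u ∨ ∃ q, p = u ++ q ∧ q <+: v := by
  obtain ⟨t, ht⟩ := h
  rcases append_eq_append_iff.1 ht with ⟨a, h1, -⟩ | ⟨b, h1, h2⟩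
  · exact Or.inl ⟨a, h1.symm⟩
  · exact Or.inr ⟨b, h1, ⟨t, h2.symm⟩⟩

theorem length_le_of_prefix_flatMap {B : Set A} {f : A → List A} {K : ℕ} {l p : List A}
    (hK : ∀ x ∈ l, ∀ q, q <+: f x → (∀ y ∈ q, y ∈ B) → q.length ≤ K)
    (hp : p <+: l.flatMap f) (hB : ∀ y ∈ p, y ∈ B) : p.length ≤ l.length * K := by
  induction l generalizing p with
  | nil => simp_all
  | cons a l ih =>
    rw [flatMap_cons] at hp
    rw [length_cons, Nat.succ_mul]
    rcases prefix_append_cases hp with h | ⟨q, rfl, hq⟩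
    · exact (hK a (by simp) p h hB).trans (Nat.le_add_left _ _)
    · have h1 := hK a (by simp) (f a) prefix_rfl fun y hy => hB y (by simp [hy])
      have h2 := ih (fun x hx => hK x (by simp [hx])) hq fun y hy => hB y (by simp [hy])
      rw [length_append]
      omega

theorem infix_or_length_le_of_infix_flatMap {B : Set A} {f : A → List A} {K : ℕ} {l w : List A}
    (hK : ∀ x ∈ l, ∀ q, q <+: f x → (∀ y ∈ q, y ∈ B) → q.length ≤ K)
    (hK' : ∀ x ∈ l, ∀ q, q <:+ f x → (∀ y ∈ q, y ∈ B) → q.length ≤ K)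
    (hw : w <:+: l.flatMap f) (hB : ∀ y ∈ w, y ∈ B) :
    (∃ x ∈ l, w <:+: f x) ∨ w.length ≤ l.length * K := by
  induction l generalizing w with
  | nil => simp_all
  | cons a l ih =>
    rw [flatMap_cons] at hw
    rw [length_cons, Nat.succ_mul]
    rcases infix_append_iff.1 hw with h | h | ⟨s, p, rfl, hs, hp⟩
    · exact Or.inl ⟨a, by simp, h⟩
    · rcases ih (fun x hx => hK x (by simp [hx])) (fun x hx => hK' x (by simp [hx])) h hB with
        ⟨x, hx, hxw⟩ | hl
      · exact Or.inl ⟨x, by simp [hx], hxw⟩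
      · exact Or.inr (by omega)
    · have h1 := hK' a (by simp) s hs fun y hy => hB y (by simp [hy])
      have h2 := length_le_of_prefix_flatMap (fun x hx => hK x (by simp [hx])) hp
        fun y hy => hB y (by simp [hy])
      refine Or.inr ?_
      rw [length_append]
      omega

theorem exists_desubstitution_of_prefix {f : A → List A} {M : ℕ} (hM : ∀ a, (f a).length ≤ M)
    {l p : List A} (hp : p <+: l.flatMap f) :
    ∃ l' q, l' <+: l ∧ p = l'.flatMap f ++ q ∧ q.length ≤ M := by
  induction l generalizing p with
  | nil => exact ⟨[], [], by simp_all⟩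
  | cons a l ih =>
    rw [flatMap_cons] at hp
    rcases prefix_append_cases hp with h | ⟨q, rfl, hq⟩
    · exact ⟨[], p, by simp, by simp, h.length_le.trans (hM a)⟩
    · obtain ⟨l', q', hl, rfl, hq'⟩ := ih hq
      exact ⟨a :: l', q', (prefix_cons_inj a).2 hl, by simp, hq'⟩

theorem exists_desubstitution_of_infix {f : A → List A} {M : ℕ} (hM : ∀ a, (f a).length ≤ M)
    {l w : List A} (hw : w <:+: l.flatMap f) :
    ∃ s l' q, l' <:+: l ∧ w = s ++ l'.flatMap f ++ q ∧ s.length ≤ M ∧ q.length ≤ M := by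
  induction l generalizing w with
  | nil => exact ⟨[], [], [], by simp_all⟩
  | cons a l ih =>
    rw [flatMap_cons] at hw
    rcases infix_append_iff.1 hw with h | h | ⟨s, p, rfl, hs, hp⟩
    · exact ⟨w, [], [], by simp, by simp, h.length_le.trans (hM a), by simp⟩
    · obtain ⟨s, l', q, hl, h⟩ := ih h
      exact ⟨s, l', q, infix_cons hl, h⟩
    · obtain ⟨l', q, hl, rfl, hq⟩ := exists_desubstitution_of_prefix hM hp
      exact ⟨s, l', q, infix_cons hl.isInfix, by simp, hs.length_le.trans (hM a), hq⟩

theorem exists_length_le [Finite A] (f : A → List A) : ∃ M, ∀ a, (f a).length ≤ M := by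
  obtain ⟨M, hM⟩ := Finite.bddAbove_range fun a => (f a).length
  exact ⟨M, fun a => hM ⟨a, rfl⟩⟩

/-! ### Factors without growing letters -/

/-- If no letter of `D` reproduces itself behind a nonempty word over `B`, then the prefixes
over `B` of the iterates of letters of `D` have bounded length. -/
theorem exists_length_prefix_le [Finite A] {τ : A → List A} (hτ : NonErasing τ) {B D : Set A}
    {M : ℕ} (hM : ∀ b ∈ B, ∀ n, (iterW τ n [b]).length ≤ M)
    (hB : ∀ b ∈ B, ∀ n, ∀ x ∈ iterW τ n [b], x ∈ B) (hDB : ∀ c ∈ D, c ∉ B)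
    (hD : ∀ c ∈ D, ∃ u, ∃ d ∈ D, ∃ v, (∀ x ∈ u, x ∈ B) ∧ τ c = u ++ d :: v)
    (hiso : ∀ c ∈ D, ∀ n, 1 ≤ n → ∀ u v : List A, u ≠ [] → (∀ b ∈ u, b ∈ B) →
      iterW τ n [c] ≠ u ++ c :: v) :
    ∃ K, ∀ c ∈ D, ∀ n p, p <+: iterW τ n [c] → (∀ x ∈ p, x ∈ B) → p.length ≤ K := by
  have hD' : ∀ c : D, ∃ (u : List A) (d : D) (v : List A), (∀ x ∈ u, x ∈ B) ∧ τ c = u ++ (d : A) :: v := fun c =>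
    let ⟨u, d, hd, v, h⟩ := hD c c.2
    ⟨u, ⟨d, hd⟩, v, h⟩
  choose u g v huB hu using hD'
  have key : ∀ n (c : D), ∃ U V, iterW τ n [(c : A)] = U ++ (g^[n] c : A) :: V ∧
      (∀ x ∈ U, x ∈ B) ∧ U.length ≤ (∑ i ∈ Finset.range n, (u (g^[i] c)).length) * M ∧
      (1 ≤ n → u c ≠ [] → U ≠ []) := by
    intro n
    induction n with
    | zero => exact fun c => ⟨[], [], by simp [iterW_zero]⟩
    | succ n ih =>
      intro c
      obtain ⟨U, V, h1, h2, h3, -⟩ := ih (g c)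
      refine ⟨iterW τ n (u c) ++ U, V ++ iterW τ n (v c), ?_, ?_, ?_, ?_⟩
      · rw [iterW_succ_singleton, hu c, ← singleton_append, iterW_append, iterW_append, h1]
        simp
      · intro x hx
        rcases mem_append.1 hx with hx | hx
        · obtain ⟨a, ha, hxa⟩ := (mem_iterW_iff _ _ _ _).1 hx
          exact hB a (huB c a ha) n x hxa
        · exact h2 x hx
      · have h4 : (iterW τ n (u c)).length ≤ (u c).length * M := by
          rw [iterW_eq_flatMap]
          refine length_le_of_prefix_flatMap (B := Set.univ) (fun x hx q hq _ => ?_) prefix_rfl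
            fun _ _ => trivial
          exact hq.length_le.trans (hM x (huB c x hx) n)
        rw [Finset.sum_range_succ', add_mul, length_append]
        simp only [Function.iterate_succ_apply, Function.iterate_zero, id_eq] at h3 ⊢
        omega
      · intro _ hc
        simp [iterW_ne_nil hτ n hc]
  have hsum : ∀ n (c : D), ∑ i ∈ Finset.range n, (u (g^[i] c)).length ≤
      ∑ᶠ d : D, (u d).length := by
    intro n c
    have := Fintype.ofFinite D
    rw [finsum_eq_sum_of_fintype]
    have hinj : Set.InjOn (fun i => g^[i] c)
        ((Finset.range n).filter fun i => (u (g^[i] c)).length ≠ 0 : Finset ℕ) := by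
      have : ∀ i j, i < j → u (g^[i] c) ≠ [] → g^[i] c ≠ g^[j] c := by
        intro i j hij hi heq
        obtain ⟨U, V, h1, h2, -, h4⟩ := key (j - i) (g^[i] c)
        rw [← Function.iterate_add_apply, Nat.sub_add_cancel hij.le, ← heq] at h1
        exact hiso _ (g^[i] c).2 (j - i) (by omega) U V (h4 (by omega) hi) h2 h1
      intro i hi j hj heq
      simp only [Finset.coe_filter, Set.mem_ofPred_eq, ne_eq, length_eq_zero_iff] at hi hj heq
      rcases lt_trichotomy i j with h | h | h
      · exact absurd heq (this i j h hi.2)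
      · exact h
      · exact absurd heq.symm (this j i h hj.2)
    rw [← Finset.sum_filter_ne_zero, ← Finset.sum_image (f := fun d => (u d).length) hinj]
    exact Finset.sum_le_sum_of_subset (Finset.subset_univ _)
  refine ⟨(∑ᶠ d : D, (u d).length) * M, fun c hc n p hp hpB => ?_⟩
  obtain ⟨U, V, h1, -, h3, -⟩ := key n ⟨c, hc⟩
  have hUp : p.length ≤ U.length := by
    by_contra! hlt
    have hpre : U ++ [(g^[n] ⟨c, hc⟩ : A)] <+: p :=
      prefix_of_prefix_length_le (l₃ := iterW τ n [c]) ⟨V, by simp [h1]⟩ hp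
        (by simpa using hlt)
    exact hDB _ (g^[n] ⟨c, hc⟩).2 (hpB _ (hpre.subset (by simp)))
  exact hUp.trans (h3.trans (Nat.mul_le_mul_right _ (hsum n _)))

theorem exists_first_mem {B D : Set A} {l : List A} (hl : ∀ x ∈ l, x ∈ D ∪ B)
    (hex : ∃ x ∈ l, x ∈ D) : ∃ u, ∃ d ∈ D, ∃ v, (∀ x ∈ u, x ∈ B) ∧ l = u ++ d :: v := by
  induction l with
  | nil => simp at hex
  | cons a l ih =>
    by_cases ha : a ∈ D
    · exact ⟨[], a, ha, l, by simp⟩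
    · have haB : a ∈ B := (hl a (by simp)).resolve_left ha
      obtain ⟨u, d, hd, v, hu, rfl⟩ := ih (fun x hx => hl x (by simp [hx])) (by
        obtain ⟨x, hx, hxD⟩ := hex
        rcases mem_cons.1 hx with rfl | hx
        · exact absurd hxD ha
        · exact ⟨x, hx, hxD⟩)
      exact ⟨a :: u, d, hd, v, by simpa [haB] using hu, by simp⟩

/-- If no letter of `D` is isolated with respect to `B`, then the factors over `B` of the
iterates of letters of `D` have bounded length. -/
theorem exists_length_infix_le [Finite A] {τ : A → List A} (hτ : NonErasing τ) {B D : Set A}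
    {M : ℕ} (hM : ∀ b ∈ B, ∀ n, (iterW τ n [b]).length ≤ M)
    (hB : ∀ b ∈ B, ∀ n, ∀ x ∈ iterW τ n [b], x ∈ B) (hDB : ∀ c ∈ D, c ∉ B)
    (hDD : ∀ c ∈ D, ∀ x ∈ τ c, x ∈ D ∪ B) (hex : ∀ c ∈ D, ∃ x ∈ τ c, x ∈ D)
    (hleft : ∀ c ∈ D, ∀ n, 1 ≤ n → ∀ u v : List A, u ≠ [] → (∀ b ∈ u, b ∈ B) →
      iterW τ n [c] ≠ u ++ c :: v)
    (hright : ∀ c ∈ D, ∀ n, 1 ≤ n → ∀ u v : List A, u ≠ [] → (∀ b ∈ u, b ∈ B) →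
      iterW τ n [c] ≠ v ++ c :: u) :
    ∃ L, ∀ c ∈ D, ∀ n w, w <:+: iterW τ n [c] → (∀ x ∈ w, x ∈ B) → w.length ≤ L := by
  obtain ⟨K₁, hK₁⟩ := exists_length_prefix_le hτ hM hB hDB
    (fun c hc => exists_first_mem (hDD c hc) (hex c hc)) hleft
  obtain ⟨K₂, hK₂⟩ := exists_length_prefix_le (τ := fun a => (τ a).reverse) (B := B) (D := D)
    (M := M) (fun a => by simpa using hτ a)
    (by simpa only [iterW_reverse_singleton, length_reverse] using hM)
    (by simpa only [iterW_reverse_singleton, mem_reverse] using hB) hDB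
    (fun c hc => exists_first_mem (by simpa using hDD c hc) (by simpa using hex c hc))
    (fun c hc n hn u v hu huB h => hright c hc n hn u.reverse v.reverse (by simpa using hu)
      (by simpa using huB) (by
        rw [iterW_reverse_singleton, reverse_eq_iff] at h
        simpa using h))
  obtain ⟨T, hT⟩ := exists_length_le τ
  set K := K₁ + K₂ + M with hK
  refine ⟨T * K + M + 1, fun c hc n => ?_⟩
  induction n generalizing c with
  | zero =>
    intro w hw _
    have := hw.length_le
    simp only [iterW_zero, length_singleton] at this
    omega
  | succ n ih =>
    intro w hw hwB
    rw [iterW_succ_singleton, iterW_eq_flatMap] at hw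
    have hcase := infix_or_length_le_of_infix_flatMap (K := K) (fun x hx q hq hqB => ?_)
      (fun x hx q hq hqB => ?_) hw hwB
    · rcases hcase with ⟨x, hx, hwx⟩ | hle
      · rcases hDD c hc x hx with hxD | hxB
        · exact ih x hxD w hwx hwB
        · have := hwx.length_le.trans (hM x hxB n)
          omega
      · have := Nat.mul_le_mul_right K (hT c)
        omega
    · rcases hDD c hc x hx with hxD | hxB
      · have := hK₁ x hxD n q hq hqB
        omega
      · have := hq.length_le.trans (hM x hxB n)
        omega
    · rcases hDD c hc x hx with hxD | hxB
      · have := hK₂ x hxD n q.reverse (by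
          rw [iterW_reverse_singleton]; exact reverse_prefix.2 hq) (by simpa using hqB)
        rw [length_reverse] at this
        omega
      · have := hq.length_le.trans (hM x hxB n)
        omega

/-! ### Uniform recurrence -/

/-- If `τ` is primitive on `D` and no letter of `D` is isolated with respect to `B`, then every
long enough factor of the iterates of `τ` occurs in all the sufficiently longer ones. -/
theorem exists_recurrence [Finite A] {τ : A → List A} (hτ : NonErasing τ) {B D : Set A}
    {M : ℕ} (hM : ∀ b ∈ B, ∀ n, (iterW τ n [b]).length ≤ M)
    (hB : ∀ b ∈ B, ∀ n, ∀ x ∈ iterW τ n [b], x ∈ B) (hDB : ∀ c ∈ D, c ∉ B)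
    (hDD : ∀ c ∈ D, ∀ x ∈ τ c, x ∈ D ∪ B) (hex : ∀ c ∈ D, ∃ x ∈ τ c, x ∈ D)
    (hleft : ∀ c ∈ D, ∀ n, 1 ≤ n → ∀ u v : List A, u ≠ [] → (∀ b ∈ u, b ∈ B) →
      iterW τ n [c] ≠ u ++ c :: v)
    (hright : ∀ c ∈ D, ∀ n, 1 ≤ n → ∀ u v : List A, u ≠ [] → (∀ b ∈ u, b ∈ B) →
      iterW τ n [c] ≠ v ++ c :: u)
    (hprim : ∀ c ∈ D, ∃ n, ∀ m, n ≤ m → ∀ d ∈ D, d ∈ iterW τ m [c])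
    {u : List A} (hu : ∃ a ∈ D ∪ B, ∃ n, u <:+: iterW τ n [a]) (hlen : M < u.length) :
    ∃ R, ∀ w, (∃ a ∈ D ∪ B, ∃ n, w <:+: iterW τ n [a]) → R ≤ w.length → u <:+: w := by
  obtain ⟨L, hL⟩ := exists_length_infix_le hτ hM hB hDB hDD hex hleft hright
  have hmemD : ∀ {v : List A} {a n}, a ∈ D ∪ B → v <:+: iterW τ n [a] → M < v.length →
      a ∈ D := fun ha hv hlt =>
    ha.resolve_right fun hb => (hv.length_le.trans (hM _ hb _)).not_gt hlt
  obtain ⟨a, ha, n, hun⟩ := hu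
  have haD := hmemD ha hun hlen
  have hclosed : ∀ m, ∀ c ∈ D, ∀ x ∈ iterW τ m [c], x ∈ D ∪ B := by
    intro m
    induction m with
    | zero => intro c hc x hx; simp only [iterW_zero, mem_singleton] at hx; exact Or.inl (hx ▸ hc)
    | succ m ih =>
      intro c hc x hx
      rw [iterW_succ_singleton] at hx
      obtain ⟨y, hy, hxy⟩ := (mem_iterW_iff _ _ _ _).1 hx
      rcases hDD c hc y hy with hyD | hyB
      · exact ih y hyD x hxy
      · exact Or.inr (hB y hyB m x hxy)
  obtain ⟨N, hN⟩ : ∃ N, ∀ d ∈ D, u <:+: iterW τ N [d] := by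
    choose! g hg using hprim
    obtain ⟨N₀, hN₀⟩ := Finite.bddAbove_range g
    refine ⟨n + N₀, fun d hd => ?_⟩
    have had : a ∈ iterW τ N₀ [d] := hg d hd N₀ (hN₀ ⟨d, rfl⟩) a haD
    obtain ⟨s, t, hst⟩ := append_of_mem had
    rw [iterW_add]
    exact hun.trans (iterW_infix τ n ⟨s, t, by simp [hst]⟩)
  obtain ⟨T, hT⟩ := exists_length_le fun a => iterW τ N [a]
  refine ⟨M + T + T + L * T + T + 1, fun w ⟨c, hc, m, hw⟩ hwl => ?_⟩
  have hcD := hmemD hc hw (by omega)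
  have hNm : N ≤ m := by
    by_contra! hlt
    have h1 := hw.length_le
    have h2 := monotone_length_iterW hτ [c] hlt.le
    have h3 := hT c
    simp only at h2 h3
    omega
  obtain ⟨r, rfl⟩ := Nat.exists_eq_add_of_le hNm
  rw [iterW_add, iterW_eq_flatMap τ N] at hw
  obtain ⟨s, l, q, hl, rfl, hs, hq⟩ := exists_desubstitution_of_infix hT hw
  obtain ⟨d, hdl, hdD⟩ : ∃ d ∈ l, d ∈ D := by
    by_contra! hno
    have h1 : l.length ≤ L := hL c hcD r l hl fun x hx =>
      (hclosed r c hcD x (hl.subset hx)).resolve_left (hno x hx)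
    have h2 : (l.flatMap fun a => iterW τ N [a]).length ≤ l.length * T :=
      length_le_of_prefix_flatMap (B := Set.univ)
        (fun x _ q hq _ => hq.length_le.trans (hT x)) prefix_rfl fun _ _ => trivial
    have h3 := Nat.mul_le_mul_right T h1
    simp only [length_append] at hwl
    omega
  exact (hN d hdD).trans ((infix_flatMap_of_mem hdl fun a => iterW τ N [a]).trans (infix_append _ _ _))

/-! ### Growing letters -/

theorem isBounded_of_mem_iterW {σ : A → List A} {a x : A} {n : ℕ} (ha : IsBounded σ a)
    (hx : x ∈ iterW σ n [a]) : IsBounded σ x := by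
  obtain ⟨K, hK⟩ := ha
  refine ⟨K, fun m => le_trans ?_ (hK (m + n))⟩
  obtain ⟨s, t, hst⟩ := append_of_mem hx
  rw [iterW_add]
  exact (iterW_infix σ m (u := [x]) ⟨s, t, by simp [hst]⟩).length_le

theorem exists_length_iterW_le [Finite A] (σ : A → List A) :
    ∃ M, ∀ b, IsBounded σ b → ∀ n, (iterW σ n [b]).length ≤ M := by
  have h : ∀ b, ∃ K, IsBounded σ b → ∀ n, (iterW σ n [b]).length ≤ K := fun b => by
    by_cases hb : IsBounded σ b
    · obtain ⟨K, hK⟩ := hb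
      exact ⟨K, fun _ => hK⟩
    · exact ⟨0, fun h => absurd h hb⟩
  choose K hK using h
  obtain ⟨M, hM⟩ := Finite.bddAbove_range K
  exact ⟨M, fun b hb n => (hK b hb n).trans (hM ⟨b, rfl⟩)⟩

theorem exists_growing_mem [Finite A] {σ : A → List A} (hσ : NonErasing σ) {c : A}
    (hc : IsGrowing σ c) (m : ℕ) : ∃ x ∈ iterW σ m [c], IsGrowing σ x := by
  by_contra! hno
  obtain ⟨M, hM⟩ := exists_length_iterW_le σ
  refine hc ⟨(iterW σ m [c]).length * M, fun n => ?_⟩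
  refine (monotone_length_iterW hσ [c] (Nat.le_add_right n m)).trans ?_
  simp only [iterW_add]
  rw [iterW_eq_flatMap σ n]
  exact length_le_of_prefix_flatMap (B := Set.univ)
    (fun x hx q hq _ => hq.length_le.trans (hM x (not_not.1 (hno x hx)) n))
    prefix_rfl fun _ _ => trivial

theorem mem_iterate_FAlph {σ : A → List A} {S : Set A} (hS : ∀ c ∈ S, IsGrowing σ c) (n : ℕ)
    (d : A) : d ∈ (FAlph σ)^[n] S ↔ IsGrowing σ d ∧ ∃ c ∈ S, d ∈ iterW σ n [c] := by
  induction n generalizing d with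
  | zero =>
    simp only [Function.iterate_zero, id_eq, iterW_zero, mem_singleton, exists_eq_right']
    exact ⟨fun h => ⟨hS d h, h⟩, fun h => h.2⟩
  | succ n ih =>
    rw [Function.iterate_succ_apply']
    simp only [FAlph, Set.mem_iUnion, alphC, Set.mem_ofPred_eq, exists_prop]
    constructor
    · rintro ⟨e, he, hd, hde⟩
      obtain ⟨-, c, hc, hec⟩ := (ih e).1 he
      exact ⟨hd, c, hc, by rw [iterW_succ']; exact mem_flatMap.2 ⟨e, hec, hde⟩⟩
    · rintro ⟨hd, c, hc, hdc⟩
      rw [iterW_succ'] at hdc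
      obtain ⟨e, hec, hde⟩ := mem_flatMap.1 hdc
      refine ⟨e, (ih e).2 ⟨fun he => hd ?_, c, hc, hec⟩, hd, hde⟩
      exact isBounded_of_mem_iterW (n := 1) he (by rw [iterW_succ_singleton]; exact hde)

/-- A minimal alphabet of period `k` is covered by all high enough iterates of `σᵏ` at any of
its letters. -/
theorem exists_forall_mem_iterW_of_minimal [Finite A] {σ : A → List A} (hσ : NonErasing σ)
    {D : Set A} {k : ℕ} (hk : IsKPeriodicAlph σ D k) (hmin : IsMinimalAlph σ D) {c : A}
    (hc : c ∈ D) : ∃ n, ∀ m, n ≤ m → ∀ d ∈ D, d ∈ iterW σ (k * m) [c] := by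
  obtain ⟨-, hgrow, hkpos, hper, -⟩ := hk
  have hperm : ∀ m, (FAlph σ)^[k * m] D = D := fun m => by
    rw [Function.iterate_mul]
    exact Function.iterate_fixed hper m
  have hcs : ∀ x ∈ ({c} : Set A), IsGrowing σ x := by simpa using hgrow c hc
  have hsub : ∀ m, (FAlph σ)^[k * m] {c} ⊆ D := fun m d hd => by
    obtain ⟨hdg, e, rfl, hde⟩ := (mem_iterate_FAlph hcs _ _).1 hd
    rw [← hperm m]
    exact (mem_iterate_FAlph hgrow _ _).2 ⟨hdg, e, hc, hde⟩
  obtain ⟨i, j, hij, heq⟩ : ∃ i j, i < j ∧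
      (FAlph σ)^[k * i] {c} = (FAlph σ)^[k * j] {c} := by
    obtain ⟨i, j, hne, heq⟩ :=
      Finite.exists_ne_map_eq_of_infinite fun m : ℕ => (FAlph σ)^[k * m] {c}
    rcases lt_or_gt_of_ne hne with h | h
    · exact ⟨i, j, h, heq⟩
    · exact ⟨j, i, h, heq.symm⟩
  have hne : ((FAlph σ)^[k * i] {c}).Nonempty := by
    obtain ⟨x, hx, hxg⟩ := exists_growing_mem hσ (hgrow c hc) (k * i)
    exact ⟨x, (mem_iterate_FAlph hcs _ _).2 ⟨hxg, c, rfl, hx⟩⟩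
  have hex : ∃ p, 0 < p ∧ (FAlph σ)^[p] ((FAlph σ)^[k * i] {c}) = (FAlph σ)^[k * i] {c} := by
    refine ⟨k * (j - i), Nat.mul_pos hkpos (by omega), ?_⟩
    rw [← Function.iterate_add_apply, ← Nat.mul_add, Nat.sub_add_cancel hij.le, heq]
  have hD : (FAlph σ)^[k * i] {c} = D := hmin.2 _ (hsub i) hne
    ⟨Nat.find hex, hne, fun a ha => hgrow a (hsub i ha), (Nat.find_spec hex).1,
      (Nat.find_spec hex).2, fun j hj hj' => Nat.find_min' hex ⟨hj, hj'⟩⟩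
  refine ⟨i, fun m hm d hd => ?_⟩
  obtain ⟨r, rfl⟩ := Nat.exists_eq_add_of_le' hm
  rw [← hperm r, ← hD, ← Function.iterate_add_apply, ← Nat.mul_add] at hd
  obtain ⟨-, e, rfl, hde⟩ := (mem_iterate_FAlph hcs _ _).1 hd
  exact hde

/-! ### The subshift of a factorial language -/

/-- The factor of length `n` of `x` at position `i`. -/
def wordAt (x : ℤ → A) (i : ℤ) (n : ℕ) : List A := List.ofFn fun j : Fin n => x (i + j.1)

@[simp] theorem length_wordAt (x : ℤ → A) (i : ℤ) (n : ℕ) : (wordAt x i n).length = n := by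
  simp [wordAt]

@[simp] theorem getElem_wordAt (x : ℤ → A) (i : ℤ) (n j : ℕ) (h : j < (wordAt x i n).length) :
    (wordAt x i n)[j] = x (i + j) := by
  simp [wordAt]

theorem wordAt_add (x : ℤ → A) (i : ℤ) (m n : ℕ) :
    wordAt x i (m + n) = wordAt x i m ++ wordAt x (i + m) n := by
  simp [wordAt, ofFn_add, add_assoc]

theorem wordAt_infix (x : ℤ → A) (i : ℤ) (a b c : ℕ) :
    wordAt x (i + a) b <:+: wordAt x i (a + b + c) := by
  rw [wordAt_add, wordAt_add]
  exact infix_append _ _ _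

theorem exists_wordAt_eq_of_infix {x : ℤ → A} {i : ℤ} {n : ℕ} {u : List A}
    (h : u <:+: wordAt x i n) : ∃ j, wordAt x j u.length = u := by
  obtain ⟨s, t, hst⟩ := h
  refine ⟨i + s.length, ext_getElem (by simp) fun m h1 h2 => ?_⟩
  have h3 : (s ++ u ++ t)[s.length + m]'(by simp; omega) = u[m] := by
    simp [h2]
  have h4 : (s ++ u ++ t)[s.length + m]'(by simp; omega) = x (i + (s.length + m : ℕ)) := by
    simp only [hst, getElem_wordAt]
  rw [getElem_wordAt, ← h3, h4]
  push_cast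
  rw [add_assoc]

theorem occursIn_iff (x : ℤ → A) (u : List A) :
    OccursIn x u ↔ ∃ i, wordAt x i u.length = u := by
  refine exists_congr fun i => ⟨fun h => ext_getElem (by simp) fun m h1 h2 => ?_, fun h j => ?_⟩
  · rw [getElem_wordAt]; exact h ⟨m, h2⟩
  · rw [← getElem_wordAt x i u.length j.1 (by simp)]
    simp only [h, get_eq_getElem]

/-- The bi-infinite words all of whose factors belong to `L`. -/
def shiftOf (L : Set (List A)) : Set (ℤ → A) := {x | ∀ i n, wordAt x i n ∈ L}

theorem setOf_occursIn_eq_shiftOf (L : Set (List A)) :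
    {x : ℤ → A | ∀ u, OccursIn x u → u ∈ L} = shiftOf L := by
  ext x
  simp only [occursIn_iff, shiftOf, Set.mem_ofPred_eq]
  refine ⟨fun h i n => h _ ⟨i, by simp⟩, fun h u ⟨i, hi⟩ => hi ▸ h i _⟩

theorem isClosed_setOf_wordAt_mem [TopologicalSpace A] [DiscreteTopology A] (L : Set (List A))
    (i : ℤ) (n : ℕ) : IsClosed {x : ℤ → A | wordAt x i n ∈ L} := by
  have hcont : Continuous fun (x : ℤ → A) (j : Fin n) => x (i + j.1) := by fun_prop
  exact (isClosed_discrete {f : Fin n → A | List.ofFn f ∈ L}).preimage hcont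

theorem isClosed_shiftOf [TopologicalSpace A] [DiscreteTopology A] (L : Set (List A)) :
    IsClosed (shiftOf L) := by
  simp only [shiftOf, Set.ofPred_forall]
  exact isClosed_iInter fun i => isClosed_iInter fun n => isClosed_setOf_wordAt_mem L i n

theorem shiftT_image_shiftOf (L : Set (List A)) : shiftT '' shiftOf L = shiftOf L := by
  have hw : ∀ (x : ℤ → A) (m i : ℤ) (n : ℕ),
      wordAt (fun j => x (j + m)) i n = wordAt x (i + m) n := fun x m i n => by
    simp only [wordAt, add_right_comm]
  ext x
  constructor
  · rintro ⟨y, hy, rfl⟩ i n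
    exact hw y 1 i n ▸ hy _ n
  · intro hx
    exact ⟨fun j => x (j + -1), fun i n => hw x (-1) i n ▸ hx _ n, by funext j; simp [shiftT]⟩

theorem shiftOf_nonempty [Finite A] [TopologicalSpace A] [DiscreteTopology A]
    {L : Set (List A)} (hfac : ∀ v ∈ L, ∀ u, u <:+: v → u ∈ L)
    (hlong : ∀ n, ∃ w ∈ L, n < w.length) : (shiftOf L).Nonempty := by
  have hsub : ∀ (x : ℤ → A) (i : ℤ) (n N : ℕ), -(N : ℤ) ≤ i → i + n ≤ N →
      wordAt x (-N) (2 * N) ∈ L → wordAt x i n ∈ L := by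
    intro x i n N h1 h2 h
    have := wordAt_infix x (-N) (i + N).toNat n (N - i - n).toNat
    rw [show -(N : ℤ) + (i + N).toNat = i by omega,
      show (i + N).toNat + n + (N - i - n).toNat = 2 * N by omega] at this
    exact hfac _ h _ this
  obtain ⟨x, hx⟩ := IsCompact.nonempty_iInter_of_sequence_nonempty_isCompact_isClosed
    (fun N : ℕ => {x : ℤ → A | wordAt x (-N) (2 * N) ∈ L})
    (fun N x hx => hsub x _ _ (N + 1) (by push_cast; omega) (by push_cast; omega) hx)
    (fun N => by
      obtain ⟨w, hw, hlen⟩ := hlong (2 * N)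
      refine ⟨fun i => w.getD (i + N).toNat (w[0]'(by omega)), hfac w hw _ ?_⟩
      refine IsPrefix.isInfix (prefix_iff_eq_take.2 (ext_getElem (by simp; omega) ?_))
      intro m h1 h2
      simp only [length_wordAt] at h1
      simp only [getElem_wordAt, getElem_take]
      rw [show (-(N : ℤ) + m + N).toNat = m by omega, getD_eq_getElem _ _ (by omega)])
    (isClosed_setOf_wordAt_mem L _ _).isCompact
    (fun N => isClosed_setOf_wordAt_mem L _ _)
  refine ⟨x, fun i n => hsub x i n (i.natAbs + n) (by omega) (by omega) ?_⟩
  exact Set.mem_iInter.1 hx _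

theorem shift_mem_of_image_eq {Y : Set (ℤ → A)} (hY : shiftT '' Y = Y) {y : ℤ → A}
    (hy : y ∈ Y) (m : ℤ) : (fun i => y (i + m)) ∈ Y := by
  induction m with
  | zero => simpa using hy
  | succ m ih =>
    rw [← hY]
    exact ⟨_, ih, by funext i; simp [shiftT, add_comm, add_left_comm]⟩
  | pred m ih =>
    rw [← hY] at ih
    obtain ⟨z, hz, hzy⟩ := ih
    convert hz using 1
    funext i
    have := congrFun hzy (i - 1)
    simp only [shiftT, sub_add_cancel] at this
    rw [this]
    congr 1
    ring

theorem isMinimalSubshift_shiftOf [Finite A] [TopologicalSpace A] [DiscreteTopology A]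
    {L : Set (List A)} (hfac : ∀ v ∈ L, ∀ u, u <:+: v → u ∈ L)
    (hlong : ∀ n, ∃ w ∈ L, n < w.length) {M : ℕ}
    (hrec : ∀ u ∈ L, M < u.length → ∃ R, ∀ w ∈ L, R ≤ w.length → u <:+: w) :
    IsMinimalSubshift (shiftOf L) := by
  refine ⟨⟨shiftOf_nonempty hfac hlong, isClosed_shiftOf L, shiftT_image_shiftOf L⟩, ?_⟩
  rintro Y hYL ⟨⟨y, hy⟩, hYc, hYs⟩
  refine hYL.antisymm fun x hx => ?_
  rw [← hYc.closure_eq, mem_closure_iff]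
  intro O hO hxO
  obtain ⟨I, U, hU, hIU⟩ := isOpen_pi_iff.1 hO x hxO
  obtain ⟨N, hN⟩ : ∃ N : ℕ, ∀ i ∈ I, i.natAbs ≤ N :=
    ⟨I.sup Int.natAbs, fun i hi => Finset.le_sup (f := Int.natAbs) hi⟩
  set n := 2 * N + M + 1 with hn
  obtain ⟨R, hR⟩ := hrec (wordAt x (-N) n) (hx _ _) (by simp; omega)
  obtain ⟨m, hm⟩ := exists_wordAt_eq_of_infix (hR (wordAt y 0 R) (hYL hy _ _) (by simp))
  rw [length_wordAt] at hm
  refine ⟨fun i => y (i + (m + N)), hIU fun i hi => ?_, shift_mem_of_image_eq hYs hy _⟩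
  have hiN := hN i hi
  have hlt : (i + N).toNat < n := by omega
  have h1 := getElem_wordAt y m n (i + N).toNat (by simpa using hlt)
  have h2 := getElem_wordAt x (-N) n (i + N).toNat (by simpa using hlt)
  simp only [hm] at h1
  rw [h1, show m + ((i + N).toNat : ℤ) = i + (m + N) by omega,
    show -(N : ℤ) + ((i + N).toNat : ℤ) = i by omega] at h2
  simp only [h2]
  exact (hU i hi).2

/-- If `τ = σᵏ|_{D∪B}` is a main sub-substitution (`D ⊆ C_niso` a minimal alphabet of
period `k`), then `X_τ` is a minimal component of `X_σ`. -/
theorem stmt13 [Fintype A] [TopologicalSpace A] [DiscreteTopology A]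
    (σ : A → List A) (hσ : NonErasing σ)
    (D : Set A) (k : ℕ) (hD : ∀ c ∈ D, NonIsolated σ c)
    (hk : IsKPeriodicAlph σ D k) (hmin : IsMinimalAlph σ D) :
    Xrestr σ (D ∪ {a | IsBounded σ a}) k ⊆ Xsub σ ∧
      IsMinimalSubshift (Xrestr σ (D ∪ {a | IsBounded σ a}) k) := by
  refine ⟨fun x hx u hu => let ⟨a, _, n, h⟩ := hx u hu; ⟨a, _, h⟩, ?_⟩
  obtain ⟨M, hM⟩ := exists_length_iterW_le σ
  have hgrow := hk.2.1
  obtain ⟨c₀, hc₀⟩ := hk.1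
  have hX : Xrestr σ (D ∪ {a | IsBounded σ a}) k =
      shiftOf {u | ∃ a ∈ D ∪ {a | IsBounded σ a}, ∃ n, u <:+: iterW σ (k * n) [a]} :=
    setOf_occursIn_eq_shiftOf _
  rw [hX]
  refine isMinimalSubshift_shiftOf (M := M) ?_ ?_ ?_
  · rintro v ⟨a, ha, n, hv⟩ u huv
    exact ⟨a, ha, n, huv.trans hv⟩
  · intro n
    have hc := hgrow c₀ hc₀
    simp only [IsGrowing, IsBounded, not_exists, not_forall, not_le] at hc
    obtain ⟨m, hm⟩ := hc n
    exact ⟨_, ⟨c₀, Or.inl hc₀, m, infix_rfl⟩, hm.trans_le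
      (monotone_length_iterW hσ [c₀] (Nat.le_mul_of_pos_left m hk.2.2.1))⟩
  · intro u hu hlen
    have key := exists_recurrence (τ := fun a => iterW σ k [a]) (B := {a | IsBounded σ a})
      (D := D) (M := M) (u := u) (fun a => iterW_ne_nil hσ k (by simp))
    simp only [iterW_iterW] at key
    refine key (fun b hb n => hM b hb _) (fun b hb n x hx => isBounded_of_mem_iterW hb hx)
      hgrow ?_ ?_ ?_ ?_ (fun c hc => exists_forall_mem_iterW_of_minimal hσ hk hmin hc) hu hlen
    · intro c hc x hx
      by_cases hxb : IsBounded σ x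
      · exact Or.inr hxb
      · left
        rw [← hk.2.2.2.1]
        exact (mem_iterate_FAlph hgrow k x).2 ⟨hxb, c, hc, hx⟩
    · intro c hc
      obtain ⟨x, hx, hxg⟩ := exists_growing_mem hσ (hgrow c hc) k
      refine ⟨x, hx, ?_⟩
      rw [← hk.2.2.2.1]
      exact (mem_iterate_FAlph hgrow k x).2 ⟨hxg, c, hc, hx⟩
    · intro c hc n hn u v hu huB h
      exact (hD c hc).2.1 ⟨hgrow c hc, k * n, Nat.mul_pos hk.2.2.1 hn, u, v, hu, huB, h⟩
    · intro c hc n hn u v hu huB h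
      exact (hD c hc).2.2 ⟨hgrow c hc, k * n, Nat.mul_pos hk.2.2.1 hn, u, v, hu, huB, h⟩

end SubstPaper
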